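/- Let A(y), B(y) be quadratic forms over an algebraically closed field of characteristic zero in n ≥ 1 variables, such that rank(A) ≥ 5 and every form in the pencil spanned by A and B has rank at least 2. Let L(y) be a nonzero linear form. Then the variety A = B = 0 has a point y with L(y) ≠ 0 at which the gradients ∇A(y) and ∇B(y) are not proportional. -/

import Mathlib

open Matrix Polynomial

section Auxiliary

variable {K V : Type*} [Field K] [AddCommGroup V] [Module K V]

/-- A function on a vector space whose restriction to every parametrized line is polynomial. -/
def PolynomialOnLines (f : V → K) : Prop :=
  ∀ x y : V, ∃ p : K[X], ∀ t : K, p.eval t = f (x + t • y)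

lemma PolynomialOnLines.mul {f g : V → K} (hf : PolynomialOnLines f) (hg : PolynomialOnLines g) :
    PolynomialOnLines fun x => f x * g x := fun x y => by
  obtain ⟨p, hp⟩ := hf x y
  obtain ⟨q, hq⟩ := hg x y
  exact ⟨p * q, fun t => by simp [hp, hq]⟩

lemma PolynomialOnLines.sub {f g : V → K} (hf : PolynomialOnLines f) (hg : PolynomialOnLines g) :
    PolynomialOnLines fun x => f x - g x := fun x y => by
  obtain ⟨p, hp⟩ := hf x y
  obtain ⟨q, hq⟩ := hg x y
  exact ⟨p - q, fun t => by simp [hp, hq]⟩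

lemma polynomialOnLines_const (c : K) : PolynomialOnLines fun _ : V => c :=
  fun _ _ => ⟨C c, fun t => by simp⟩

lemma polynomialOnLines_linear (φ : V →ₗ[K] K) : PolynomialOnLines fun x => φ x :=
  fun x y => ⟨C (φ x) + C (φ y) * X, fun t => by simp; ring⟩

lemma polynomialOnLines_quadratic (a : V →ₗ[K] V →ₗ[K] K) : PolynomialOnLines fun x => a x x :=
  fun x y => ⟨C (a x x) + X * C (a x y + a y x) + X ^ 2 * C (a y y), fun t => by simp; ring⟩

lemma exists_eval_ne_zero [CharZero K] {p : K[X]} (hp : p ≠ 0) : ∃ t, p.eval t ≠ 0 := by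
  by_contra! h
  exact hp (Polynomial.funext fun t => by simp [h t])

lemma PolynomialOnLines.exists_ne_zero_and_ne_zero [CharZero K] {f g : V → K}
    (hf : PolynomialOnLines f) (hg : PolynomialOnLines g) {W : Submodule K V}
    (hfW : ∃ x ∈ W, f x ≠ 0) (hgW : ∃ x ∈ W, g x ≠ 0) : ∃ x ∈ W, f x ≠ 0 ∧ g x ≠ 0 := by
  obtain ⟨x, hx, hfx⟩ := hfW
  obtain ⟨y, hy, hgy⟩ := hgW
  obtain ⟨p, hp⟩ := hf x (y - x)
  obtain ⟨q, hq⟩ := hg x (y - x)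
  have hp0 : p ≠ 0 := by
    rintro rfl
    exact hfx (by simpa using (hp 0).symm)
  have hq0 : q ≠ 0 := by
    rintro rfl
    exact hgy (by simpa using (hq 1).symm)
  obtain ⟨t, ht⟩ := exists_eval_ne_zero (mul_ne_zero hp0 hq0)
  rw [eval_mul, hp, hq] at ht
  exact ⟨_, W.add_mem hx (W.smul_mem t (W.sub_mem hy hx)), left_ne_zero_of_mul ht,
    right_ne_zero_of_mul ht⟩

/-- A binary quadratic with nonzero discriminant has a simple root off a given point. -/
lemma exists_simple_root_quadratic [IsAlgClosed K] [CharZero K] {α β γ m n : K} (hα : α ≠ 0)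
    (hdisc : β ^ 2 - γ * α ≠ 0) (hn : n ≠ 0) :
    ∃ t, α * t ^ 2 + 2 * β * t + γ = 0 ∧ α * t + β ≠ 0 ∧ m + t * n ≠ 0 := by
  obtain ⟨s, hs⟩ := IsAlgClosed.exists_pow_nat_eq (β ^ 2 - γ * α) (n := 2) (by norm_num)
  have hs0 : s ≠ 0 := by
    rintro rfl
    exact hdisc (by rw [← hs]; ring)
  have key : ∀ r : K, r ^ 2 = β ^ 2 - γ * α →
      α * ((-β + r) / α) ^ 2 + 2 * β * ((-β + r) / α) + γ = 0 := fun r hr => by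
    field_simp
    linear_combination hr
  by_cases h : m + (-β + s) / α * n = 0
  · refine ⟨(-β + -s) / α, key _ (by rw [← hs]; ring), ?_, fun h' => ?_⟩
    · rw [mul_div_cancel₀ _ hα]
      simpa using hs0
    · field_simp at h h'
      have : 2 * s * n = 0 := by linear_combination h - h'
      simp [hs0, hn] at this
  · refine ⟨(-β + s) / α, key _ hs, ?_, h⟩
    rw [mul_div_cancel₀ _ hα]
    simpa using hs0

/-- A cubic with nonzero discriminant has a simple root off the zero set of a nonzero affine
function. -/
lemma exists_simple_root_cubic [IsAlgClosed K] (P : Cubic K) (ha : P.a ≠ 0)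
    (hdisc : P.discr ≠ 0) {m n : K} (hmn : n ≠ 0 ∨ m ≠ 0) :
    ∃ t, P.a * t ^ 3 + P.b * t ^ 2 + P.c * t + P.d = 0 ∧
      3 * P.a * t ^ 2 + 2 * P.b * t + P.c ≠ 0 ∧ m + t * n ≠ 0 := by
  obtain ⟨x, y, z, h3⟩ := (Cubic.splits_iff_roots_eq_three (φ := RingHom.id K) ha).1
    (IsAlgClosed.splits _)
  have hb := Cubic.b_eq_three_roots ha h3
  have hc := Cubic.c_eq_three_roots ha h3
  have hd := Cubic.d_eq_three_roots ha h3
  obtain ⟨hxy, hxz, hyz⟩ := (Cubic.discr_ne_zero_iff_roots_ne ha h3).1 hdisc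
  simp only [RingHom.id_apply] at hb hc hd
  by_cases h : m + x * n = 0
  · refine ⟨y, ?_, ?_, fun h' => ?_⟩
    · rw [hb, hc, hd]; ring
    · rw [hb, hc]
      have := mul_ne_zero (mul_ne_zero ha (sub_ne_zero.2 hxy.symm)) (sub_ne_zero.2 hyz)
      contrapose! this
      linear_combination this
    · have h0 : (x - y) * n = 0 := by linear_combination h - h'
      have hn : n = 0 := (mul_eq_zero.1 h0).resolve_left (sub_ne_zero.2 hxy)
      subst hn
      simp_all
  · refine ⟨x, ?_, ?_, h⟩
    · rw [hb, hc, hd]; ring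
    · rw [hb, hc]
      have := mul_ne_zero (mul_ne_zero ha (sub_ne_zero.2 hxy)) (sub_ne_zero.2 hxz)
      contrapose! this
      linear_combination this

/-- If a symmetric bilinear form vanishes on the diagonal of `W`, it vanishes on `W`. -/
lemma bilin_eq_zero_of_diag [CharZero K] {a : V →ₗ[K] V →ₗ[K] K} (ha : ∀ x y, a x y = a y x)
    {W : Submodule K V} (h : ∀ x ∈ W, a x x = 0) {x y : V} (hx : x ∈ W) (hy : y ∈ W) :
    a x y = 0 := by
  have h1 := h _ (W.add_mem hx hy)
  simp only [map_add, LinearMap.add_apply, h x hx, h y hy, ha y x] at h1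
  have h2 : 2 * a x y = 0 := by linear_combination h1
  simpa using h2

/-- If the Gram determinant of `d` and `x` vanishes for all `x ∈ W`, then a vector of `W`
orthogonal to the anisotropic vector `d` is orthogonal to `W`. -/
lemma bilin_eq_zero_of_gram [CharZero K] {a : V →ₗ[K] V →ₗ[K] K} (ha : ∀ x y, a x y = a y x)
    {W : Submodule K V} {d : V} (hd : a d d ≠ 0)
    (h : ∀ x ∈ W, a x d * a x d - a x x * a d d = 0) {x y : V} (hx : x ∈ W) (hy : y ∈ W)
    (hxd : a x d = 0) : a x y = 0 := by
  have h1 := h _ (W.add_mem hx hy)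
  have h2 := h x hx
  have h3 := h y hy
  simp only [map_add, LinearMap.add_apply, ha y x, hxd] at h1 h2
  have h4 : 2 * (a x y * a d d) = 0 := by linear_combination -h1 + h2 + h3
  simpa [hd] using h4

lemma polynomialOnLines_gram (a : V →ₗ[K] V →ₗ[K] K) (d : V) :
    PolynomialOnLines fun x => a x d * a x d - a x x * a d d :=
  ((polynomialOnLines_linear (a.flip d)).mul (polynomialOnLines_linear (a.flip d))).sub
    ((polynomialOnLines_quadratic a).mul (polynomialOnLines_const _))

/-- A quadratic form of rank at least two on `W` has a smooth zero off a given hyperplane. -/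
lemma exists_smooth_zero [IsAlgClosed K] [CharZero K] {a : V →ₗ[K] V →ₗ[K] K}
    (ha : ∀ x y, a x y = a y x) {W : Submodule K V}
    (hrank : ∀ d ∈ W, ∃ x ∈ W, a x d = 0 ∧ ∃ u ∈ W, a x u ≠ 0)
    (l : V →ₗ[K] K) (hl : ∃ x ∈ W, l x ≠ 0) :
    ∃ z ∈ W, a z z = 0 ∧ l z ≠ 0 ∧ ∃ u ∈ W, a z u ≠ 0 := by
  have hne : ∃ x ∈ W, a x x ≠ 0 := by
    by_contra! h
    obtain ⟨x, hx, -, u, hu, hxu⟩ := hrank 0 W.zero_mem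
    exact hxu (bilin_eq_zero_of_diag ha h hx hu)
  obtain ⟨d, hdW, hd, hld⟩ := (polynomialOnLines_quadratic a).exists_ne_zero_and_ne_zero
    (polynomialOnLines_linear l) hne hl
  obtain ⟨q, hqW, hq⟩ : ∃ q ∈ W, a q d * a q d - a q q * a d d ≠ 0 := by
    by_contra! h
    obtain ⟨x, hx, hxd, u, hu, hxu⟩ := hrank d hdW
    exact hxu (bilin_eq_zero_of_gram ha hd h hx hu hxd)
  obtain ⟨t, h0, h1, h2⟩ := exists_simple_root_quadratic (β := a q d) (γ := a q q) (m := l q) hd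
    (by rwa [sq]) hld
  refine ⟨q + t • d, W.add_mem hqW (W.smul_mem t hdW), ?_, by simpa using h2, d, hdW, ?_⟩
  · simp only [map_add, LinearMap.add_apply, map_smul, LinearMap.smul_apply, smul_eq_mul, ha d q]
    linear_combination h0
  · simp only [map_add, LinearMap.add_apply, map_smul, LinearMap.smul_apply, smul_eq_mul]
    contrapose! h1
    linear_combination h1

lemma exists_apply_eq_one_and_eq_zero {f g : V →ₗ[K] K}
    (h : ∀ c d : K, (∀ u, c * f u + d * g u = 0) → c = 0 ∧ d = 0) :
    ∃ e, f e = 1 ∧ g e = 0 := by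
  obtain ⟨u₀, hu₀⟩ : ∃ u, g u ≠ 0 := by
    by_contra! hg
    exact one_ne_zero (h 0 1 fun u => by simp [hg u]).2
  obtain ⟨e, hge, hfe⟩ : ∃ e, g e = 0 ∧ f e ≠ 0 := by
    by_contra! hf
    refine one_ne_zero (h 1 (-(f u₀ / g u₀)) fun u => ?_).1
    have h1 := hf (u - (g u / g u₀) • u₀) (by simp [hu₀])
    simp only [map_sub, map_smul, smul_eq_mul] at h1
    linear_combination h1
  exact ⟨(f e)⁻¹ • e, by simp [hfe], by simp [hge]⟩

/-- The intersection of two quadrics, one of rank at least five, contains a point at which that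
quadric is smooth. -/
lemma exists_common_zero [IsAlgClosed K] [CharZero K] {a b : V →ₗ[K] V →ₗ[K] K}
    (ha : ∀ x y, a x y = a y x) (hb : ∀ x y, b x y = b y x)
    (hrank : ∀ φ : Fin 4 → V →ₗ[K] K, ∃ x, (∀ i, φ i x = 0) ∧ ∃ u, a x u ≠ 0) :
    ∃ v, a v v = 0 ∧ b v v = 0 ∧ ∃ u, a v u ≠ 0 := by
  obtain ⟨x₀, -, u₀, h₀⟩ := hrank 0
  obtain ⟨p, -, hp, -, p', -, hpp'⟩ := exists_smooth_zero (W := ⊤) ha (fun d _ => by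
    obtain ⟨x, hx, u, hu⟩ := hrank fun _ => a.flip d
    exact ⟨x, trivial, hx 0, u, trivial, hu⟩) (a x₀) ⟨u₀, trivial, h₀⟩
  have hW : ∀ d, ∃ x ∈ LinearMap.ker (a p), a x d = 0 ∧ ∃ u ∈ LinearMap.ker (a p), a x u ≠ 0 := by
    intro d
    obtain ⟨x, hx, u, hu⟩ := hrank ![a p, a p', a d, 0]
    have h1 : a p x = 0 := hx 0
    have h2 : a p' x = 0 := hx 1
    have h3 : a d x = 0 := hx 2
    refine ⟨x, h1, by rw [ha, h3], u - (a p u / a p p') • p', ?_, ?_⟩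
    · simp [hpp']
    · simpa [ha x p', h2] using hu
  obtain ⟨x₁, -, -, u₁, hu₁, h₁⟩ := hW 0
  obtain ⟨r, hpr, hr, -, u, hpu, hru⟩ := exists_smooth_zero ha (fun d _ => hW d) (a x₁)
    ⟨u₁, hu₁, h₁⟩
  rw [LinearMap.mem_ker] at hpr hpu
  by_cases hbp : b p p = 0
  · exact ⟨p, hp, hbp, p', hpp'⟩
  obtain ⟨t, ht⟩ := IsAlgClosed.exists_root
    (C (b p p) * X ^ 2 + C (2 * b p r) * X + C (b r r)) (by
      rw [degree_quadratic hbp]; norm_num)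
  refine ⟨t • p + r, ?_, ?_, u, ?_⟩
  · simp [hp, hr, hpr, ha r p]
  · simp only [IsRoot.def, eval_add, eval_mul, eval_C, eval_pow, eval_X] at ht
    simp only [map_add, LinearMap.add_apply, map_smul, LinearMap.smul_apply, smul_eq_mul, hb r p]
    linear_combination ht
  · simpa [hpu] using hru

/-- Two quadratic forms `a`, `b`, with `a` of rank at least five and every member of the pencil of
rank at least two, have a common zero with independent gradients. -/
lemma exists_smooth_common_zero [IsAlgClosed K] [CharZero K] {a b : V →ₗ[K] V →ₗ[K] K}
    (ha : ∀ x y, a x y = a y x) (hb : ∀ x y, b x y = b y x)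
    (hrank : ∀ φ : Fin 4 → V →ₗ[K] K, ∃ x, (∀ i, φ i x = 0) ∧ ∃ u, a x u ≠ 0)
    (hpencil : ∀ (s : K) (φ : V →ₗ[K] K), ∃ x, φ x = 0 ∧ ∃ u, (s • a + b) x u ≠ 0) :
    ∃ v, a v v = 0 ∧ b v v = 0 ∧
      ∀ c d : K, (∀ u, c * a v u + d * b v u = 0) → c = 0 ∧ d = 0 := by
  obtain ⟨v, hav, hbv, u₀, hu₀⟩ := exists_common_zero ha hb hrank
  by_contra! hcon
  obtain ⟨c, d, hcd, hne⟩ := hcon v hav hbv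
  have hd : d ≠ 0 := by
    rintro rfl
    refine hne ?_ rfl
    simpa [hu₀] using hcd u₀
  set b' := (c / d) • a + b with hb'
  have hb's : ∀ x y, b' x y = b' y x := fun x y => by simp [hb', ha x y, hb x y]
  have hb'v : ∀ u, b' v u = 0 := fun u => by
    have := hcd u
    simp only [hb', LinearMap.add_apply, LinearMap.smul_apply, smul_eq_mul]
    field_simp
    linear_combination this
  obtain ⟨z, -, hz, hvz, u₁, -, hu₁⟩ := exists_smooth_zero (W := ⊤) hb's (fun w _ => by
    obtain ⟨x, hx, u, hu⟩ := hpencil (c / d) (b'.flip w)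
    exact ⟨x, trivial, hx, u, trivial, hu⟩) (a v) ⟨u₀, trivial, hu₀⟩
  obtain ⟨y, hy⟩ : ∃ y, y = z - (a z z / (2 * a v z)) • v := ⟨_, rfl⟩
  have hay : a y y = 0 := by
    simp only [hy, map_sub, LinearMap.sub_apply, map_smul, LinearMap.smul_apply, smul_eq_mul, hav,
      ha z v]
    field_simp
    ring
  have hb'y : ∀ u, b' y u = b' z u := fun u => by simp [hy, hb'v]
  have hby : b y y = 0 := by
    have h1 : b' y y = 0 := by rw [hb'y, hb's, hb'y, hz]
    simpa [hb', hay] using h1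
  have hayv : a y v ≠ 0 := by simpa [hy, hav, ha z v] using hvz
  obtain ⟨c', d', hcd', hne'⟩ := hcon y hay hby
  have h1 : ∀ u, (c' - d' * (c / d)) * a y u + d' * b' y u = 0 := fun u => by
    simp only [hb', LinearMap.add_apply, LinearMap.smul_apply, smul_eq_mul]
    linear_combination hcd' u
  have h2 : c' - d' * (c / d) = 0 := by
    have := h1 v
    rw [hb's y v, hb'v] at this
    simpa [hayv] using this
  have h3 : d' = 0 := by
    have := h1 u₁
    rw [h2, hb'y] at this
    simpa [hu₁] using this
  subst h3
  exact hne' (by simpa using h2) rfl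

/-- Once the intersection of two quadrics, the first of rank at least five, has one smooth point,
it has a smooth point off any given hyperplane. -/
lemma exists_smooth_common_zero_off_hyperplane [IsAlgClosed K] [CharZero K]
    {a b : V →ₗ[K] V →ₗ[K] K} (ha : ∀ x y, a x y = a y x) (hb : ∀ x y, b x y = b y x)
    (hrank : ∀ φ : Fin 4 → V →ₗ[K] K, ∃ x, (∀ i, φ i x = 0) ∧ ∃ u, a x u ≠ 0)
    {v : V} (hav : a v v = 0) (hbv : b v v = 0)
    (hv : ∀ c d : K, (∀ u, c * a v u + d * b v u = 0) → c = 0 ∧ d = 0)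
    (l : V →ₗ[K] K) (hl : l ≠ 0) :
    ∃ y, a y y = 0 ∧ b y y = 0 ∧ l y ≠ 0 ∧
      ∀ c d : K, (∀ u, c * a y u + d * b y u = 0) → c = 0 ∧ d = 0 := by
  by_cases hlv : l v ≠ 0
  · exact ⟨v, hav, hbv, hlv, hv⟩
  rw [not_not] at hlv
  obtain ⟨e, hve, hbve, hae⟩ : ∃ e, a v e = 1 ∧ b v e = 0 ∧ a e e = 0 := by
    obtain ⟨e, h1, h2⟩ := exists_apply_eq_one_and_eq_zero hv
    refine ⟨e - (a e e / 2) • v, by simp [h1, hav], by simp [h2, hbv], ?_⟩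
    simp only [map_sub, LinearMap.sub_apply, map_smul, LinearMap.smul_apply, smul_eq_mul, hav,
      ha e v, h1]
    ring
  set W : Submodule K V := LinearMap.ker (a v) ⊓ LinearMap.ker (a e) with hW
  have memW : ∀ x, x ∈ W ↔ a v x = 0 ∧ a e x = 0 := fun x => by simp [hW]
  have hproj : ∀ x, x - a v x • e - a e x • v ∈ W := fun x => by
    simp [memW, hve, hav, hae, ha e v]
  have hperp : ∀ x ∈ W, (∃ u, a x u ≠ 0) → ∃ u ∈ W, a x u ≠ 0 := by
    rintro x hx ⟨u, hu⟩
    rw [memW] at hx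
    exact ⟨_, hproj u, by simpa [ha x v, ha x e, hx.1, hx.2] using hu⟩
  have hQ : ∃ x ∈ W, a x x ≠ 0 := by
    by_contra! h
    obtain ⟨x, hx, hu⟩ := hrank ![a v, a e, 0, 0]
    have hxW : x ∈ W := (memW x).2 ⟨hx 0, hx 1⟩
    obtain ⟨u, huW, hu⟩ := hperp x hxW hu
    exact hu (bilin_eq_zero_of_diag ha h hxW huW)
  have hk : ∃ x ∈ W, b v x ≠ 0 := by
    obtain ⟨w, h1, h2⟩ := exists_apply_eq_one_and_eq_zero (f := b v) (g := a v)
      fun c d h => (hv d c fun u => by rw [add_comm]; exact h u).symm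
    exact ⟨_, hproj w, by simp [h1, h2, hbv]⟩
  obtain ⟨d, hdW, ⟨hd, hkd⟩, hld⟩ :
      ∃ d ∈ W, (a d d ≠ 0 ∧ b v d ≠ 0) ∧ (l d ≠ 0 ∨ l e ≠ 0) := by
    by_cases hle : l e ≠ 0
    · obtain ⟨d, h1, h2⟩ := (polynomialOnLines_quadratic a).exists_ne_zero_and_ne_zero
        (polynomialOnLines_linear (b v)) hQ hk
      exact ⟨d, h1, h2, Or.inr hle⟩
    rw [not_not] at hle
    have hlW : ∃ x ∈ W, l x ≠ 0 := by
      obtain ⟨z, hz⟩ := DFunLike.ne_iff.1 hl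
      exact ⟨_, hproj z, by simpa [hle, hlv] using hz⟩
    obtain ⟨w, hwW, hw⟩ := (polynomialOnLines_linear (b v)).exists_ne_zero_and_ne_zero
      (polynomialOnLines_linear l) hk hlW
    obtain ⟨d, h1, h2, h3⟩ := (polynomialOnLines_quadratic a).exists_ne_zero_and_ne_zero
      ((polynomialOnLines_linear (b v)).mul (polynomialOnLines_linear l)) hQ
      ⟨w, hwW, mul_ne_zero hw.1 hw.2⟩
    exact ⟨d, h1, ⟨h2, left_ne_zero_of_mul h3⟩, Or.inl (right_ne_zero_of_mul h3)⟩
  obtain ⟨had, hed⟩ := (memW d).1 hdW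
  set U : Submodule K V := W ⊓ LinearMap.ker (b v) with hU
  have hUrank : ∃ x ∈ U, a x d = 0 ∧ ∃ u ∈ U, a x u ≠ 0 := by
    obtain ⟨x, hx, hu⟩ := hrank ![a v, a e, b v, a d]
    have hxW : x ∈ W := (memW x).2 ⟨hx 0, hx 1⟩
    have hxv : b v x = 0 := hx 2
    have hxd : a d x = 0 := hx 3
    obtain ⟨u, huW, hu⟩ := hperp x hxW hu
    refine ⟨x, ⟨hxW, hxv⟩, by rw [ha, hxd], u - (b v u / b v d) • d,
      ⟨W.sub_mem huW (W.smul_mem _ hdW), by simp [hkd]⟩, by simpa [ha x d, hxd] using hu⟩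
  obtain ⟨x₁, hx₁, hx₁d, u₁, hu₁, hxu₁⟩ := hUrank
  obtain ⟨q, ⟨hqW, hqv⟩, hq, hqd⟩ := (polynomialOnLines_quadratic a).exists_ne_zero_and_ne_zero
    (polynomialOnLines_gram a d) (W := U)
    (by by_contra! h; exact hxu₁ (bilin_eq_zero_of_diag ha h hx₁ hu₁))
    (by by_contra! h; exact hxu₁ (bilin_eq_zero_of_gram ha hd h hx₁ hu₁ hx₁d))
  replace hqv : b v q = 0 := hqv
  obtain ⟨haq, heq⟩ := (memW q).1 hqW
  -- the family of cubics whose zeros parametrize points of the intersection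
  let P : Cubic K[X] :=
    ⟨C (-(a d d * b v d)), X * C (b d d) - C (2 * a q d * b v d),
      X * (X * C (2 * b e d) + C (2 * b q d)) - C (a q q * b v d),
      X * (X ^ 2 * C (b e e) + X * C (2 * b e q) + C (b q q))⟩
  have hP0 : P.discr ≠ 0 := fun h => by
    have h1 : (P.discr).eval 0 = 4 * (b v d ^ 4 * (a q q ^ 2 *
        (a q d * a q d - a q q * a d d))) := by
      simp [P, Cubic.discr]
      ring
    rw [h, eval_zero] at h1
    simp [hkd, hq, hqd] at h1
  obtain ⟨ε, hε, hεP, hεl⟩ : ∃ ε : K, ε ≠ 0 ∧ (P.discr).eval ε ≠ 0 ∧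
      (l d ≠ 0 ∨ ε * l e + l q ≠ 0) := by
    by_cases h : l d ≠ 0
    · obtain ⟨ε, h1⟩ := exists_eval_ne_zero (mul_ne_zero X_ne_zero hP0)
      rw [eval_mul, eval_X] at h1
      exact ⟨ε, left_ne_zero_of_mul h1, right_ne_zero_of_mul h1, Or.inl h⟩
    · have hne : X * C (l e) + C (l q) ≠ 0 := fun h0 => by
        have := congrArg (fun p => coeff p 1) h0
        simp [coeff_C] at this
        exact (hld.resolve_left h) this
      obtain ⟨ε, h1⟩ := exists_eval_ne_zero (mul_ne_zero (mul_ne_zero X_ne_zero hP0) hne)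
      simp only [eval_mul, eval_X, eval_add, eval_C] at h1
      exact ⟨ε, left_ne_zero_of_mul (left_ne_zero_of_mul h1),
        right_ne_zero_of_mul (left_ne_zero_of_mul h1), Or.inr (right_ne_zero_of_mul h1)⟩
  obtain ⟨t, ht, ht', hlt⟩ := exists_simple_root_cubic
    ⟨P.a.eval ε, P.b.eval ε, P.c.eval ε, P.d.eval ε⟩ (by simp [P, hd, hkd])
    (by simpa [Cubic.discr] using hεP) hεl
  simp only [P, eval_sub, eval_add, eval_mul, eval_X, eval_C, eval_pow] at ht ht'
  clear_value W U
  have hvq := ha q v; have hvd := ha d v; have heq' := ha q e; have hed' := ha d e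
  have hev := ha e v
  obtain ⟨y, hy⟩ : ∃ y, y = ε • (ε • e + (q + t • d)) -
      ((a q q + 2 * t * a q d + t ^ 2 * a d d) / 2) • v := ⟨_, rfl⟩
  refine ⟨y, ?_, ?_, ?_, fun c c' h => ?_⟩
  · simp only [hy, map_add, map_sub, LinearMap.add_apply, LinearMap.sub_apply, map_smul,
      LinearMap.smul_apply, smul_eq_mul, hav, hae, hev, hve, hvq, hvd, heq', hed', haq, had, heq,
      hed, ha d q]
    ring
  · simp only [hy, map_add, map_sub, LinearMap.add_apply, LinearMap.sub_apply, map_smul,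
      LinearMap.smul_apply, smul_eq_mul, hbv, hb e v, hb q v, hb d v, hbve, hqv, hb d q, hb d e,
      hb q e]
    linear_combination ε * ht
  · have h1 : l y = ε * (ε * l e + l q + t * l d) := by
      simp only [hy, map_add, map_sub, map_smul, smul_eq_mul, hlv]
      ring
    rw [h1]
    exact mul_ne_zero hε hlt
  · have h1 := h (ε • d - (a q d + t * a d d) • v)
    have h2 := h v
    simp only [hy, map_add, map_sub, LinearMap.add_apply, LinearMap.sub_apply, map_smul,
      LinearMap.smul_apply, smul_eq_mul, hav, hev, hve, hvq, hvd, haq, had, hed, hbv, hb e v,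
      hb q v, hb d v, hbve, hqv] at h1 h2
    have h3 : c' = 0 := by
      by_contra hc'
      exact mul_ne_zero (mul_ne_zero hc' hε) ht' (by linear_combination 2 * h1)
    subst h3
    refine ⟨?_, rfl⟩
    have h5 : c * ε ^ 2 = 0 := by linear_combination h2
    simpa [hε] using h5

/-- Fewer linear conditions than the rank of a matrix do not force a vector into its kernel. -/
lemma Matrix.exists_mulVec_ne_zero_of_lt_rank {n k : ℕ} {M : Matrix (Fin n) (Fin n) K}
    (hM : k < M.rank) (φ : Fin k → (Fin n → K) →ₗ[K] K) :
    ∃ x, (∀ i, φ i x = 0) ∧ M *ᵥ x ≠ 0 := by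
  by_contra! h
  have hle : LinearMap.ker (LinearMap.pi φ) ≤ LinearMap.ker M.mulVecLin := fun x hx => by
    simp only [LinearMap.mem_ker, funext_iff, LinearMap.pi_apply, Pi.zero_apply] at hx
    simpa using h x hx
  have h1 := Submodule.finrank_mono hle
  have h2 := (LinearMap.pi φ).finrank_range_add_finrank_ker
  have h3 := M.mulVecLin.finrank_range_add_finrank_ker
  have h4 := Submodule.finrank_le (LinearMap.range (LinearMap.pi φ))
  rw [Module.finrank_fin_fun] at h4
  change k < Module.finrank K (LinearMap.range M.mulVecLin) at hM
  omega

lemma Matrix.IsSymm.toBilin'_comm {n : ℕ} {M : Matrix (Fin n) (Fin n) K} (hM : M.IsSymm)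
    (x y : Fin n → K) : Matrix.toBilin' M x y = Matrix.toBilin' M y x := by
  rw [Matrix.toBilin'_apply', Matrix.toBilin'_apply', dotProduct_mulVec, ← mulVec_transpose,
    hM.eq, dotProduct_comm]

lemma Matrix.IsSymm.exists_toBilin'_ne_zero {n : ℕ} {M : Matrix (Fin n) (Fin n) K}
    (hM : M.IsSymm) {x : Fin n → K} (hx : M *ᵥ x ≠ 0) : ∃ u, Matrix.toBilin' M x u ≠ 0 := by
  obtain ⟨i, hi⟩ := Function.ne_iff.1 hx
  exact ⟨Pi.single i 1, by simpa [hM.toBilin'_comm x, Matrix.toBilin'_apply'] using hi⟩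

end Auxiliary

/-- Let `A, B` be quadratic forms (given by symmetric matrices `MA, MB`) over an algebraically
closed field of characteristic zero, with `rank A ≥ 5` and every form in the pencil of rank
at least `2`, and let `L` be a nonzero linear form.  Then `A = B = 0` has a point `y` with
`L(y) ≠ 0` at which the gradients `∇A(y) = 2 MA y` and `∇B(y) = 2 MB y` are not proportional. -/
theorem quadric_pencil_smooth_point (K : Type*) [Field K] [IsAlgClosed K] [CharZero K]
    (n : ℕ) (MA MB : Matrix (Fin n) (Fin n) K) (hMA : MA.IsSymm) (hMB : MB.IsSymm)
    (hrank : 5 ≤ MA.rank)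
    (hpencil : ∀ α β : K, ¬(α = 0 ∧ β = 0) → 2 ≤ (α • MA + β • MB).rank)
    (l : Fin n → K) (hl : l ≠ 0) :
    ∃ y : Fin n → K,
      y ⬝ᵥ MA.mulVec y = 0 ∧ y ⬝ᵥ MB.mulVec y = 0 ∧ (∑ i, l i * y i) ≠ 0 ∧
      ∀ c d : K, c • MA.mulVec y + d • MB.mulVec y = 0 → c = 0 ∧ d = 0 := by
  have hcomm := hMA.toBilin'_comm
  have hcomm' := hMB.toBilin'_comm
  have hA : ∀ φ : Fin 4 → (Fin n → K) →ₗ[K] K,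
      ∃ x, (∀ i, φ i x = 0) ∧ ∃ u, Matrix.toBilin' MA x u ≠ 0 := fun φ => by
    obtain ⟨x, hx, hne⟩ := Matrix.exists_mulVec_ne_zero_of_lt_rank (k := 4) hrank φ
    exact ⟨x, hx, hMA.exists_toBilin'_ne_zero hne⟩
  obtain ⟨v, hav, hbv, hv⟩ := exists_smooth_common_zero hcomm hcomm' hA fun s φ => by
    have hsymm : (s • MA + (1 : K) • MB).IsSymm := (hMA.smul s).add (hMB.smul 1)
    obtain ⟨x, hx, hne⟩ := Matrix.exists_mulVec_ne_zero_of_lt_rank (k := 1)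
      (hpencil s 1 (by simp)) fun _ => φ
    obtain ⟨u, hu⟩ := hsymm.exists_toBilin'_ne_zero hne
    exact ⟨x, hx 0, u, by simpa using hu⟩
  have hl' : dotProductBilin K K l ≠ 0 := fun h => hl (funext fun i => by
    simpa using LinearMap.congr_fun h (Pi.single i 1))
  obtain ⟨y, hay, hby, hly, hy⟩ := exists_smooth_common_zero_off_hyperplane hcomm hcomm' hA hav hbv
    hv (dotProductBilin K K l) hl'
  refine ⟨y, by rwa [← Matrix.toBilin'_apply'], by rwa [← Matrix.toBilin'_apply'],
    by simpa [dotProduct] using hly, fun c d h => hy c d fun u => ?_⟩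
  rw [hcomm y u, hcomm' y u, Matrix.toBilin'_apply', Matrix.toBilin'_apply', ← smul_eq_mul,
    ← smul_eq_mul, ← dotProduct_smul, ← dotProduct_smul, ← dotProduct_add, h, dotProduct_zero]
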